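/- arXiv:2504.01773 — 2 statements merged into one kernel-verified Lean document; each statement's English description precedes it below -/
import Mathlib

section
/- Recovering Marginals of XOS Functions: Let f : 2^A → [0,1] be an XOS function on a finite set A. Then for any sets T ⊆ S ⊆ A, there exists a subset U ⊆ T such that f(U) ≥ (1/2)·f(T) and f_U(i) ≥ (1/2)·f_S(i) for every i ∈ U. -/
open scoped BigOperators ENNReal
open Finset

/-- Marginal contribution of agent `i` to set `S`: `f_S(i) = f(S) - f(S \ {i})`. -/
noncomputable def marginal {α : Type*} [DecidableEq α] (f : Finset α → ℝ) (S : Finset α)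
    (i : α) : ℝ :=
  f S - f (S.erase i)

/-- Payment needed to incentivize `S`, valued in `[0,∞]`, with the conventions
`0/0 = 0` and `x/0 = ∞` for `x > 0` (these hold for ENNReal division). -/
noncomputable def payment {α : Type*} [DecidableEq α] (f : Finset α → ℝ) (c : α → ℝ)
    (S : Finset α) : ℝ≥0∞ :=
  ∑ i ∈ S, ENNReal.ofReal (c i) / ENNReal.ofReal (marginal f S i)

/-- The principal's profit from incentivizing `S`: `g(S) = (1 - p(S)) · f(S)`. -/
noncomputable def profit {α : Type*} [DecidableEq α] (f : Finset α → ℝ) (c : α → ℝ)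
    (S : Finset α) : ℝ :=
  (1 - (payment f c S).toReal) * f S

/-- `f` is monotone. -/
def IsMonotoneFn {α : Type*} (f : Finset α → ℝ) : Prop :=
  ∀ ⦃S T : Finset α⦄, S ⊆ T → f S ≤ f T

/-- `f` is subadditive. -/
def IsSubadditive {α : Type*} [DecidableEq α] (f : Finset α → ℝ) : Prop :=
  ∀ S T : Finset α, f (S ∪ T) ≤ f S + f T

/-- `f` is submodular (decreasing marginal values). -/
def IsSubmodular {α : Type*} [DecidableEq α] (f : Finset α → ℝ) : Prop :=
  ∀ ⦃S T : Finset α⦄, S ⊆ T → ∀ i ∉ T, f (insert i T) - f T ≤ f (insert i S) - f S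

/-- `f` is additive. -/
def IsAdditive {α : Type*} [DecidableEq α] (f : Finset α → ℝ) : Prop :=
  ∀ S : Finset α, f S = ∑ i ∈ S, f {i}

/-- `f` is XOS: a finite max of nonnegative additive functions. -/
def IsXOS {α : Type*} (f : Finset α → ℝ) : Prop :=
  ∃ (k : ℕ) (a : Fin (k + 1) → α → ℝ),
    (∀ j i, 0 ≤ a j i) ∧
    ∀ S : Finset α, f S = Finset.univ.sup' Finset.univ_nonempty (fun j => ∑ i ∈ S, a j i)

/-- Agent `i` is light: it can be incentivized with payment at most `1/2`. -/
def isLight {α : Type*} [DecidableEq α] (f : Finset α → ℝ) (c : α → ℝ) (i : α) : Prop :=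
  payment f c {i} ≤ ENNReal.ofReal (1 / 2)

/-- `S` is budget-feasible for budget `B`. -/
def feasible {α : Type*} [DecidableEq α] (f : Finset α → ℝ) (c : α → ℝ) (B : ℝ)
    (S : Finset α) : Prop :=
  payment f c S ≤ ENNReal.ofReal B

/-- `S` is a budget-feasible set of light agents. -/
def feasibleLight {α : Type*} [DecidableEq α] (f : Finset α → ℝ) (c : α → ℝ) (B : ℝ)
    (S : Finset α) : Prop :=
  (∀ i ∈ S, isLight f c i) ∧ payment f c S ≤ ENNReal.ofReal B

/-- The maximum (supremum) value of objective `φ` over sets satisfying `P`. -/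
noncomputable def maxVal {α : Type*} (φ : Finset α → ℝ) (P : Finset α → Prop) : ℝ :=
  sSup (φ '' {S | P S})

/-- `φ` is a BEST objective for the instance `(f, c)`: it is nonnegative, sandwiched between
profit and reward, and satisfies `φ(S) ≤ f(S \ {i}) + φ({i})` for `i ∈ S`. -/
def IsBEST {α : Type*} [DecidableEq α] (f : Finset α → ℝ) (c : α → ℝ)
    (φ : Finset α → ℝ) : Prop :=
  (∀ S, 0 ≤ φ S) ∧
  (∀ S, φ S ≤ f S) ∧
  (∀ S, payment f c S ≤ 1 → (1 - (payment f c S).toReal) * f S ≤ φ S) ∧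
  (∀ S, ∀ i ∈ S, φ S ≤ f (S.erase i) + φ {i})

/-- `φ` is a BEST objective for the instance `(f, c)` restricted to sets satisfying `P`. -/
def IsBESTOn {α : Type*} [DecidableEq α] (f : Finset α → ℝ) (c : α → ℝ)
    (P : Finset α → Prop) (φ : Finset α → ℝ) : Prop :=
  (∀ S, P S → 0 ≤ φ S) ∧
  (∀ S, P S → φ S ≤ f S) ∧
  (∀ S, P S → payment f c S ≤ 1 → (1 - (payment f c S).toReal) * f S ≤ φ S) ∧
  (∀ S, P S → ∀ i ∈ S, φ S ≤ f (S.erase i) + φ {i})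

/-- The marginals of an XOS function with respect to `S` sum over `T ⊆ S` to at most `f T`. -/
theorem IsXOS.sum_marginal_le {α : Type*} [DecidableEq α] {f : Finset α → ℝ} (hf : IsXOS f)
    {S T : Finset α} (hTS : T ⊆ S) : ∑ i ∈ T, marginal f S i ≤ f T := by
  obtain ⟨k, a, -, hfa⟩ := hf
  have le_f (j : Fin (k + 1)) (R : Finset α) : ∑ i ∈ R, a j i ≤ f R := by
    rw [hfa R]
    exact Finset.le_sup' (fun j => ∑ i ∈ R, a j i) (Finset.mem_univ j)
  obtain ⟨j, -, hj⟩ := Finset.exists_mem_eq_sup' Finset.univ_nonempty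
    (fun j => ∑ i ∈ S, a j i)
  rw [← hfa S] at hj
  refine (Finset.sum_le_sum fun i hi => ?_).trans (le_f j T)
  have hsum := Finset.add_sum_erase S (a j) (hTS hi)
  have herase := le_f j (S.erase i)
  unfold marginal
  linarith

theorem IsXOS.isMonotoneFn {α : Type*} {f : Finset α → ℝ} (hf : IsXOS f) : IsMonotoneFn f := by
  obtain ⟨k, a, ha, hfa⟩ := hf
  intro S T hST
  rw [hfa S, hfa T]
  exact Finset.sup'_mono_fun fun j _ =>
    Finset.sum_le_sum_of_subset_of_nonneg hST fun i _ _ => ha j i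

/-- **Recovering Marginals of XOS Functions.** -/
theorem xos_recover_marginals {α : Type*} [DecidableEq α] [Fintype α]
    (f : Finset α → ℝ)
    (hf01 : ∀ S, f S ∈ Set.Icc (0 : ℝ) 1) (hxos : IsXOS f)
    (T S : Finset α) (hTS : T ⊆ S) :
    ∃ U ⊆ T,
      (1 / 2 : ℝ) * f T ≤ f U ∧
      ∀ i ∈ U, (1 / 2 : ℝ) * marginal f S i ≤ marginal f U i := by
  -- `U` is a demand set within `T` at prices equal to half the marginals with respect to `S`.
  obtain ⟨U, hU, hmax⟩ := Finset.exists_max_image T.powerset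
    (fun V => f V - ∑ i ∈ V, (1 / 2 : ℝ) * marginal f S i) ⟨T, Finset.mem_powerset_self T⟩
  rw [Finset.mem_powerset] at hU
  refine ⟨U, hU, ?_, fun i hi => ?_⟩
  · have hT := hmax T (Finset.mem_powerset_self T)
    have hprice : 0 ≤ ∑ i ∈ U, (1 / 2 : ℝ) * marginal f S i :=
      Finset.sum_nonneg fun i _ =>
        mul_nonneg (by norm_num) (sub_nonneg.2 (hxos.isMonotoneFn (S.erase_subset i)))
    have hsum := hxos.sum_marginal_le hTS
    rw [← Finset.mul_sum T] at hT
    linarith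
  · have herase := hmax (U.erase i) (Finset.mem_powerset.2 ((U.erase_subset i).trans hU))
    have hsum := Finset.add_sum_erase U (fun i => (1 / 2 : ℝ) * marginal f S i) hi
    change _ ≤ f U - f (U.erase i)
    linarith
end

section
/- Two-Agent Lower Bound on Price of Frugality for Profit: For all budgets 0 < b < B ≤ 1 and every ε with 0 < ε < B − b and ε·(1 − b) ≤ 2b, there exists a multi-agent contract instance with two agents and additive f such that p({i}) ≤ b for both agents and Max-Profit(B) ≥ (1 − ε/2)·(2 − b) · Max-Profit(b). -/
open scoped BigOperators ENNReal
open Finset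

/-- The marginal of a member of `S` under an additive reward is its weight. -/
lemma marginal_sum {α : Type*} [DecidableEq α] (w : α → ℝ) {S : Finset α} {i : α}
    (hi : i ∈ S) : marginal (fun T => ∑ j ∈ T, w j) S i = w i := by
  have := Finset.add_sum_erase S w hi
  simp only [marginal]
  linarith

/-- Under an additive reward with positive weights `w`, costs `p i * w i` make the payment
the sum of the shares `p i`. -/
lemma payment_sum {α : Type*} [DecidableEq α] (w p : α → ℝ) (hw : ∀ i, 0 < w i)
    (hp : ∀ i, 0 ≤ p i) (S : Finset α) :
    payment (fun T => ∑ j ∈ T, w j) (fun i => p i * w i) S =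
      ENNReal.ofReal (∑ i ∈ S, p i) := by
  rw [payment, ENNReal.ofReal_sum_of_nonneg fun i _ => hp i]
  refine Finset.sum_congr rfl fun i hi => ?_
  rw [marginal_sum w hi, ← ENNReal.ofReal_div_of_pos (hw i), mul_div_cancel_right₀ _ (hw i).ne']

lemma profit_sum {α : Type*} [DecidableEq α] (w p : α → ℝ) (hw : ∀ i, 0 < w i)
    (hp : ∀ i, 0 ≤ p i) (S : Finset α) :
    profit (fun T => ∑ j ∈ T, w j) (fun i => p i * w i) S =
      (1 - ∑ i ∈ S, p i) * ∑ i ∈ S, w i := by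
  rw [profit, payment_sum w p hw hp, ENNReal.toReal_ofReal (Finset.sum_nonneg fun i _ => hp i)]

lemma finset_fin_two_cases (S : Finset (Fin 2)) :
    S = ∅ ∨ S = {0} ∨ S = {1} ∨ S = univ := by
  revert S
  decide

/-- **Two-Agent Lower Bound on Price of Frugality for Profit.** -/
theorem pof_profit_lower_two_agents (b B ε : ℝ)
    (hb : 0 < b) (hbB : b < B) (hB : B ≤ 1)
    (hε0 : 0 < ε) (hε : ε < B - b) (hε2 : ε * (1 - b) ≤ 2 * b) :
    ∃ (f : Finset (Fin 2) → ℝ) (c : Fin 2 → ℝ),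
      (∀ S, f S ∈ Set.Icc (0 : ℝ) 1) ∧ f ∅ = 0 ∧ IsAdditive f ∧ (∀ i, 0 ≤ c i) ∧
      (∀ i, payment f c {i} ≤ ENNReal.ofReal b) ∧
      (1 - ε / 2) * (2 - b) * maxVal (profit f c) (feasible f c b) ≤
        maxVal (profit f c) (feasible f c B) := by
  set d : ℝ := ε * (1 - b) / 4 with hd
  have ha : 0 < 1 - b := by linarith
  have hd0 : 0 < d := by positivity
  have hdε : d ≤ ε / 4 := by rw [hd]; nlinarith
  have hdb : d ≤ b := by rw [hd]; linarith
  have hbd : b + d ≤ B := by linarith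
  let w : Fin 2 → ℝ := ![(1 - d) / 2, (1 - b) / 2]
  let p : Fin 2 → ℝ := ![b, d]
  have hw : ∀ i, 0 < w i := by
    rw [Fin.forall_fin_two]
    constructor <;> simp [w] <;> linarith
  have hp : ∀ i, 0 ≤ p i := by
    rw [Fin.forall_fin_two]
    constructor <;> simp [p] <;> linarith
  refine ⟨fun S => ∑ i ∈ S, w i, fun i => p i * w i, fun S => ⟨?_, ?_⟩, by simp,
    fun S => by simp, fun i => mul_nonneg (hp i) (hw i).le, fun i => ?_, ?_⟩
  · exact Finset.sum_nonneg fun i _ => (hw i).le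
  · refine (Finset.sum_le_univ_sum_of_nonneg fun i => (hw i).le).trans ?_
    simp [w, Fin.sum_univ_two]
    linarith
  · rw [payment_sum w p hw hp]
    apply ENNReal.ofReal_le_ofReal
    fin_cases i <;> simp [p, hdb]
  · have hfrugal : maxVal (profit (fun S => ∑ i ∈ S, w i) fun i => p i * w i)
        (feasible (fun S => ∑ i ∈ S, w i) (fun i => p i * w i) b) ≤ (1 - b) * ((1 - d) / 2) := by
      refine csSup_le ⟨_, ∅, by simp [feasible, payment], rfl⟩ ?_
      rintro _ ⟨S, hS, rfl⟩
      rw [Set.mem_ofPred_eq, feasible, payment_sum w p hw hp, ENNReal.ofReal_le_ofReal_iff hb.le]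
        at hS
      rw [profit_sum w p hw hp]
      rcases finset_fin_two_cases S with rfl | rfl | rfl | rfl
      · have : 0 ≤ (1 - b) * ((1 - d) / 2) := mul_nonneg ha.le (by linarith)
        simpa using this
      · simp [p, w]
      · simp only [p, w, Finset.sum_singleton, Matrix.cons_val_one, Matrix.cons_val_fin_one]
        exact le_of_eq (by ring)
      · simp [p, Fin.sum_univ_two] at hS
        linarith
    have hfull : (1 - (b + d)) * ((1 - d) / 2 + (1 - b) / 2) ≤
        maxVal (profit (fun S => ∑ i ∈ S, w i) fun i => p i * w i)
          (feasible (fun S => ∑ i ∈ S, w i) (fun i => p i * w i) B) := by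
      refine le_csSup (Set.toFinite _).bddAbove ⟨univ, ?_, ?_⟩
      · rw [Set.mem_ofPred_eq, feasible, payment_sum w p hw hp]
        apply ENNReal.ofReal_le_ofReal
        simpa [p, Fin.sum_univ_two] using hbd
      · rw [profit_sum w p hw hp]
        simp [p, w, Fin.sum_univ_two]
    refine (mul_le_mul_of_nonneg_left hfrugal
      (mul_nonneg (by linarith) (by linarith))).trans (le_trans ?_ hfull)
    have hgap : (1 - (b + d)) * ((1 - d) / 2 + (1 - b) / 2) -
        (1 - ε / 2) * (2 - b) * ((1 - b) * ((1 - d) / 2)) =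
        (1 - b) / 2 * ((1 - ε / 4) * ((1 - b) * d) + ε / 4 * ((2 - b) * (1 - d))) := by
      rw [hd]; ring
    have h₁ : 0 ≤ (1 - ε / 4) * ((1 - b) * d) := mul_nonneg (by linarith) (by positivity)
    have h₂ : 0 ≤ ε / 4 * ((2 - b) * (1 - d)) :=
      mul_nonneg (by linarith) (mul_nonneg (by linarith) (by linarith))
    have h₃ := mul_nonneg (half_pos ha).le (add_nonneg h₁ h₂)
    linarith
end
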